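/- Let X be a complete metric space with a geodesic structure σ that is Busemann convex, let n ≥ 1 be real, and suppose the n-dimensional Hausdorff measure μH n is locally finite, positive on every nonempty open set, and satisfies MCP(0,n) with respect to σ. Let q ∈ X and R > 0, and suppose geodesics from ball q R extend to length 9R with respect to σ. Then for every p ∈ X, all x, y ∈ ball q R and every t ∈ [0,1] such that σ p x t ∈ ball q R and σ p y t ∈ ball q R, one has dist (σ p x t) (σ p y t) = t·dist x y. -/

import Mathlib

open Metric MeasureTheory ENNReal Filter

/-- A geodesic structure on a metric space. -/
structure GeodesicStructure (X : Type*) [MetricSpace X] where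
  σ : X → X → ℝ → X
  σ_zero : ∀ x y, σ x y 0 = x
  σ_one : ∀ x y, σ x y 1 = y
  dist_σ : ∀ x y, ∀ s ∈ Set.Icc (0:ℝ) 1, ∀ t ∈ Set.Icc (0:ℝ) 1,
    dist (σ x y s) (σ x y t) = |s - t| * dist x y
  σ_comp : ∀ x y, ∀ s ∈ Set.Icc (0:ℝ) 1, ∀ t ∈ Set.Icc (0:ℝ) 1,
    σ x (σ x y t) s = σ x y (s * t)

/-- Busemann convexity of a geodesic structure. -/
def GeodesicStructure.BusemannConvex {X : Type*} [MetricSpace X]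
    (G : GeodesicStructure X) : Prop :=
  ∀ p x y : X, ∀ t ∈ Set.Icc (0:ℝ) 1, dist (G.σ p x t) (G.σ p y t) ≤ t * dist x y

/-- Geodesic completeness with respect to a geodesic structure. -/
def GeodesicStructure.GeodComplete {X : Type*} [MetricSpace X]
    (G : GeodesicStructure X) : Prop :=
  ∀ x y : X, x ≠ y → ∀ R : ℝ, dist x y ≤ R →
    ∃ z : X, dist x z = R ∧ G.σ x z (dist x y / R) = y

/-- The measure contraction property MCP(0,N) with respect to a geodesic structure. -/
def GeodesicStructure.MCPzero {X : Type*} [MetricSpace X] [MeasurableSpace X]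
    (G : GeodesicStructure X) (m : Measure X) (N : ℝ) : Prop :=
  ∀ p : X, ∀ A : Set X, MeasurableSet A → ∀ t ∈ Set.Icc (0:ℝ) 1,
    ENNReal.ofReal (t ^ N) * m A ≤ m ((fun x => G.σ p x t) '' A)

/-- Geodesics from `ball q R` extend to length `9R` with respect to `G`. -/
def ExtendsTo {X : Type*} [MetricSpace X] (G : GeodesicStructure X) (q : X) (R : ℝ) : Prop :=
  ∀ x ∈ Metric.ball q R, ∀ y : X, 0 < dist x y → dist x y ≤ 9 * R →
    ∀ s : ℝ, dist x y ≤ s → s ≤ 9 * R →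
      ∃ z : X, dist x z = s ∧ G.σ x z (dist x y / s) = y

namespace GeodesicStructure

variable {X : Type*} [MetricSpace X] (G : GeodesicStructure X)

lemma dist_left_σ (x y : X) {t : ℝ} (ht : t ∈ Set.Icc (0:ℝ) 1) :
    dist x (G.σ x y t) = t * dist x y := by
  have h := G.dist_σ x y 0 (by simp) t ht
  rwa [G.σ_zero, zero_sub, abs_neg, abs_of_nonneg ht.1] at h

lemma dist_σ_right (x y : X) {t : ℝ} (ht : t ∈ Set.Icc (0:ℝ) 1) :
    dist (G.σ x y t) y = (1 - t) * dist x y := by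
  have h := G.dist_σ x y t ht 1 (by simp)
  rwa [G.σ_one, abs_sub_comm, abs_of_nonneg (sub_nonneg.2 ht.2)] at h

variable {G}

lemma BusemannConvex.image_ball_subset (hB : G.BusemannConvex) (p x : X) (r : ℝ) {t : ℝ}
    (ht : t ∈ Set.Ioc (0:ℝ) 1) :
    (fun y => G.σ p y t) '' ball x r ⊆ ball (G.σ p x t) (t * r) := by
  rintro _ ⟨y, hy, rfl⟩
  exact (hB p y x t ⟨ht.1.le, ht.2⟩).trans_lt (mul_lt_mul_of_pos_left hy ht.1)

variable [MeasurableSpace X] [BorelSpace X]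

lemma BusemannConvex.hausdorffMeasure_image_le (hB : G.BusemannConvex) {n : ℝ} (hn : 0 ≤ n)
    (p : X) (A : Set X) {t : ℝ} (ht : t ∈ Set.Icc (0:ℝ) 1) :
    μH[n] ((fun y => G.σ p y t) '' A) ≤ ENNReal.ofReal (t ^ n) * μH[n] A := by
  have hL : LipschitzOnWith t.toNNReal (fun y => G.σ p y t) A :=
    LipschitzOnWith.of_dist_le_mul fun x _ y _ => by
      rw [Real.coe_toNNReal t ht.1]; exact hB p x y t ht
  rw [← ENNReal.ofReal_rpow_of_nonneg ht.1 hn]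
  exact hL.hausdorffMeasure_image_le hn

lemma MCPzero.measure_ball_le {m : Measure X} {n : ℝ} (hMCP : G.MCPzero m n)
    (hB : G.BusemannConvex) (p x : X) (r : ℝ) {t : ℝ} (ht : t ∈ Set.Ioc (0:ℝ) 1) :
    ENNReal.ofReal (t ^ n) * m (ball x r) ≤ m (ball (G.σ p x t) (t * r)) :=
  (hMCP p _ measurableSet_ball t ⟨ht.1.le, ht.2⟩).trans
    (measure_mono (hB.image_ball_subset p x r ht))

end GeodesicStructure

namespace ExtendsTo

variable {X : Type*} [MetricSpace X] {G : GeodesicStructure X} {q : X} {R : ℝ}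

lemma ball_subset_image (hext : ExtendsTo G q R) {x : X} (hx : x ∈ ball q R) {r t : ℝ}
    (hr : r ≤ 9 * R) (ht : t ∈ Set.Ioc (0:ℝ) 1) :
    ball x (t * r) ⊆ (fun y => G.σ x y t) '' ball x r := by
  intro y hy
  rw [mem_ball'] at hy
  rcases eq_or_ne x y with rfl | hxy
  · refine ⟨x, ?_, ?_⟩
    · rw [dist_self] at hy
      exact mem_ball_self (pos_of_mul_pos_right hy ht.1.le)
    · have h := G.dist_left_σ x x ⟨ht.1.le, ht.2⟩
      rw [dist_self, mul_zero] at h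
      exact (dist_eq_zero.1 h).symm
  · have hd : 0 < dist x y := dist_pos.2 hxy
    have hs : dist x y / t < r := by rwa [div_lt_iff₀' ht.1]
    have hle : dist x y ≤ dist x y / t := le_div_self hd.le ht.1 ht.2
    obtain ⟨z, hz, hzy⟩ := hext x hx y hd (by linarith) (dist x y / t) hle (by linarith)
    refine ⟨z, by rwa [mem_ball', hz], ?_⟩
    rwa [div_div_cancel₀ hd.ne'] at hzy

variable [MeasurableSpace X] [BorelSpace X] {n : ℝ}

lemma hausdorffMeasure_ball_mul (hext : ExtendsTo G q R) (hB : G.BusemannConvex) (hn : 0 ≤ n)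
    (hMCP : G.MCPzero μH[n] n) {x : X} (hx : x ∈ ball q R) {r t : ℝ}
    (hr : r ≤ 9 * R) (ht : t ∈ Set.Ioc (0:ℝ) 1) :
    μH[n] (ball x (t * r)) = ENNReal.ofReal (t ^ n) * μH[n] (ball x r) := by
  refine le_antisymm ((measure_mono (hext.ball_subset_image hx hr ht)).trans
    (hB.hausdorffMeasure_image_le hn x _ ⟨ht.1.le, ht.2⟩)) ?_
  have h := hMCP.measure_ball_le hB x x r ht
  have h0 := G.dist_left_σ x x ⟨ht.1.le, ht.2⟩
  rw [dist_self, mul_zero] at h0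
  rwa [← dist_eq_zero.1 h0] at h

lemma hausdorffMeasure_ball_lt_top [IsLocallyFiniteMeasure (μH[n] : Measure X)]
    (hext : ExtendsTo G q R) (hB : G.BusemannConvex) (hn : 0 ≤ n)
    (hMCP : G.MCPzero μH[n] n) {x : X} (hx : x ∈ ball q R) {r : ℝ} (hr0 : 0 < r)
    (hr : r ≤ 9 * R) : μH[n] (ball x r) < ∞ := by
  obtain ⟨u, hu, hfin⟩ := Measure.finiteAt_nhds (μH[n] : Measure X) x
  obtain ⟨s, hs, hsu⟩ := Metric.mem_nhds_iff.1 hu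
  have ht : min 1 (s / r) ∈ Set.Ioc (0:ℝ) 1 := ⟨lt_min one_pos (by positivity), min_le_left _ _⟩
  have hsub : ball x (min 1 (s / r) * r) ⊆ u := (ball_subset_ball (by
    calc min 1 (s / r) * r ≤ s / r * r := by gcongr; exact min_le_right _ _
      _ = s := div_mul_cancel₀ _ hr0.ne')).trans hsu
  have h := (measure_mono hsub).trans_lt hfin
  rw [hext.hausdorffMeasure_ball_mul hB hn hMCP hx hr ht] at h
  exact ENNReal.lt_top_of_mul_ne_top_right h.ne
    (ENNReal.ofReal_pos.2 (Real.rpow_pos_of_pos ht.1 n)).ne'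

/-- Balls of equal radius centred in `ball q R` have comparable measure: contracting towards `p`
moves the centre `x` arbitrarily close to `p`. -/
lemma hausdorffMeasure_ball_le (hext : ExtendsTo G q R) (hB : G.BusemannConvex) (hn : 0 ≤ n)
    (hMCP : G.MCPzero μH[n] n) {x p : X} (hx : x ∈ ball q R) (hp : p ∈ ball q R) {r : ℝ}
    (hr0 : 0 < r) (hr : r < 9 * R) : μH[n] (ball x r) ≤ μH[n] (ball p r) := by
  have hlim : Tendsto (fun ε : ℝ => ENNReal.ofReal ((1 + ε)⁻¹ ^ n) * μH[n] (ball x r))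
      (nhdsWithin 0 (Set.Ioi 0)) (nhds (μH[n] (ball x r))) := by
    have hc : ContinuousAt (fun ε : ℝ => (1 + ε)⁻¹ ^ n) 0 := by
      refine ContinuousAt.rpow_const (ContinuousAt.inv₀ (by fun_prop) (by simp)) (by simp)
    have h := ENNReal.Tendsto.mul_const (b := μH[n] (ball x r))
      (ENNReal.tendsto_ofReal (hc.tendsto.mono_left (nhdsWithin_le_nhds (s := Set.Ioi 0))))
      (Or.inl (by simp))
    simpa using h
  refine le_of_tendsto hlim ?_
  have hw : Tendsto (fun ε : ℝ => ε * r / (2 * R)) (nhds 0) (nhds 0) := by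
    have : Continuous fun ε : ℝ => ε * r / (2 * R) := by fun_prop
    simpa using this.tendsto 0
  have hr' : Tendsto (fun ε : ℝ => (1 + ε) * r) (nhds 0) (nhds r) := by
    have : Continuous fun ε : ℝ => (1 + ε) * r := by fun_prop
    simpa using this.tendsto 0
  have hε : Tendsto (fun ε : ℝ => ε * r) (nhds 0) (nhds 0) := by
    have : Continuous fun ε : ℝ => ε * r := by fun_prop
    simpa using this.tendsto 0
  filter_upwards [self_mem_nhdsWithin,
    nhdsWithin_le_nhds (hw.eventually (gt_mem_nhds one_pos)),
    nhdsWithin_le_nhds (hr'.eventually (gt_mem_nhds hr)),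
    nhdsWithin_le_nhds (hε.eventually (gt_mem_nhds (sub_pos.2 (mem_ball.1 hp))))]
    with ε (hε0 : 0 < ε) hε1 hε2 hε3
  have hR : 0 < R := dist_nonneg.trans_lt (mem_ball.1 hp)
  have ht : ε * r / (2 * R) ∈ Set.Ioc (0:ℝ) 1 := ⟨by positivity, hε1.le⟩
  set t := ε * r / (2 * R)
  have hpx : dist p x < 2 * R := by
    have := dist_triangle_right p x q
    rw [mem_ball] at hp hx
    linarith
  have hdist : dist p (G.σ p x t) ≤ ε * r := by
    rw [G.dist_left_σ p x ⟨ht.1.le, ht.2⟩]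
    calc t * dist p x ≤ t * (2 * R) := by gcongr
      _ = ε * r := div_mul_cancel₀ _ (by positivity)
  have hwq : G.σ p x t ∈ ball q R := by
    have := dist_triangle_left (G.σ p x t) q p
    rw [mem_ball]
    linarith
  have h1 : μH[n] (ball x r) ≤ μH[n] (ball (G.σ p x t) r) := by
    have h := hMCP.measure_ball_le hB p x r ht
    rw [hext.hausdorffMeasure_ball_mul hB hn hMCP hwq hr.le ht] at h
    exact (ENNReal.mul_le_mul_iff_right
      (ENNReal.ofReal_pos.2 (Real.rpow_pos_of_pos ht.1 n)).ne' ENNReal.ofReal_ne_top).1 h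
  have h2 : μH[n] (ball (G.σ p x t) r) ≤ μH[n] (ball p ((1 + ε) * r)) := by
    refine measure_mono (ball_subset_ball' ?_)
    rw [dist_comm]
    linarith
  have h3 := hext.hausdorffMeasure_ball_mul hB hn hMCP hp hε2.le
    (t := (1 + ε)⁻¹) ⟨by positivity, inv_le_one_of_one_le₀ (by linarith)⟩
  rw [inv_mul_cancel_left₀ (by positivity)] at h3
  rw [h3]
  exact mul_le_mul' le_rfl (h1.trans h2)

end ExtendsTo

theorem busemann_mcp_local_cone_type
    (X : Type*) [MetricSpace X] [CompleteSpace X] [MeasurableSpace X] [BorelSpace X]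
    (G : GeodesicStructure X) (hB : G.BusemannConvex)
    (n : ℝ) (hn : 1 ≤ n)
    (hlf : IsLocallyFiniteMeasure (μH[n] : Measure X))
    (hpos : (μH[n] : Measure X).IsOpenPosMeasure)
    (hMCP : G.MCPzero μH[n] n)
    (q : X) (R : ℝ) (hR : 0 < R) (hext : ExtendsTo G q R) :
    ∀ p : X, ∀ x ∈ ball q R, ∀ y ∈ ball q R, ∀ t ∈ Set.Icc (0:ℝ) 1,
      G.σ p x t ∈ ball q R → G.σ p y t ∈ ball q R →
        dist (G.σ p x t) (G.σ p y t) = t * dist x y := by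
  intro p x hx y hy t ht hx' hy'
  have hn0 : 0 ≤ n := zero_le_one.trans hn
  refine le_antisymm (hB p x y t ht) (not_lt.1 fun hlt => ?_)
  have ht0 : 0 < t := ht.1.lt_of_ne fun h => by
    rw [← h, zero_mul] at hlt
    exact hlt.not_ge dist_nonneg
  have ht' : t ∈ Set.Ioc (0:ℝ) 1 := ⟨ht0, ht.2⟩
  have hd0 : 0 < dist x y := pos_of_mul_pos_right (dist_nonneg.trans_lt hlt) ht0.le
  have hd2 : dist x y < 2 * R := by
    have := dist_triangle_right x y q
    rw [mem_ball] at hx hy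
    linarith
  set x' := G.σ p x t
  set y' := G.σ p y t
  obtain ⟨r, hr⟩ : ∃ r, r = dist x y / 2 := ⟨_, rfl⟩
  have hr0 : 0 < r := by linarith
  have hr9 : r < 9 * R := by linarith
  have hconst : ∀ a ∈ ball q R, μH[n] (ball a r) = μH[n] (ball x r) := fun a ha =>
    le_antisymm (hext.hausdorffMeasure_ball_le hB hn0 hMCP ha hx hr0 hr9)
      (hext.hausdorffMeasure_ball_le hB hn0 hMCP hx ha hr0 hr9)
  have hsmall : ∀ a ∈ ball q R,
      μH[n] (ball a (t * r)) = ENNReal.ofReal (t ^ n) * μH[n] (ball x r) := fun a ha => by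
    rw [hext.hausdorffMeasure_ball_mul hB hn0 hMCP ha hr9.le ht', hconst a ha]
  have hdisj : Disjoint (ball x r) (ball y r) := ball_disjoint_ball (by linarith)
  have himage : (fun z => G.σ p z t) '' (ball x r ∪ ball y r) ⊆
      ball x' (t * r) ∪ ball y' (t * r) := by
    rw [Set.image_union]
    exact Set.union_subset_union (hB.image_ball_subset p x r ht') (hB.image_ball_subset p y r ht')
  have hunion : μH[n] (ball x' (t * r)) + μH[n] (ball y' (t * r)) ≤
      μH[n] (ball x' (t * r) ∪ ball y' (t * r)) := by
    rw [hsmall x' hx', hsmall y' hy', ← mul_add]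
    nth_rewrite 2 [← hconst y hy]
    rw [← measure_union hdisj measurableSet_ball]
    exact (hMCP p _ (measurableSet_ball.union measurableSet_ball) t ht).trans
      (measure_mono himage)
  have hhalf : (1 / 2 : ℝ) ∈ Set.Icc (0:ℝ) 1 := by norm_num
  have hmid : G.σ x' y' (1 / 2) ∈ ball x' (t * r) ∩ ball y' (t * r) := by
    have h1 := G.dist_left_σ x' y' hhalf
    have h2 := G.dist_σ_right x' y' hhalf
    have h3 : t * r = t * dist x y / 2 := by rw [hr]; ring
    exact ⟨by rw [mem_ball', h1]; linarith, by rw [mem_ball, h2]; linarith⟩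
  have hinter : 0 < μH[n] (ball x' (t * r) ∩ ball y' (t * r)) :=
    (isOpen_ball.inter isOpen_ball).measure_pos _ ⟨_, hmid⟩
  have hfin : μH[n] (ball x' (t * r) ∪ ball y' (t * r)) ≠ ∞ := by
    have hx_fin := hext.hausdorffMeasure_ball_lt_top hB hn0 hMCP hx hr0 hr9.le
    have h : ENNReal.ofReal (t ^ n) * μH[n] (ball x r) < ∞ :=
      ENNReal.mul_lt_top ENNReal.ofReal_lt_top hx_fin
    exact (measure_union_lt_top (by rwa [hsmall x' hx']) (by rwa [hsmall y' hy'])).ne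
  refine (ENNReal.lt_add_right hfin hinter.ne').not_ge ?_
  rw [measure_union_add_inter _ measurableSet_ball]
  exact hunion
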